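/- arXiv:2505.11006 — 11 statements merged into one kernel-verified Lean document; each statement's English description precedes it below -/
import Mathlib

section
/- Define V̄(λ, γ) := (1/2)·((1 + γ + λ)/√((1 − γ + λ)² + 4γλ) − 1) for γ > 0 and λ ≥ 0. Then: (i) for γ ∈ (1/2, 2) and λ ≥ 0, V̄(λ, γ) = 1 holds if and only if λ = 3√(γ/2) − γ − 1; and (ii) for γ > 0, 3√(γ/2) − γ − 1 ≥ 0 if and only if 1/2 ≤ γ ≤ 2. -/
/-- Asymptotic variance component of the conditional out-of-sample risk of linear
ridge regression (normalized by `σ_ε²`). -/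
noncomputable def Vbar (l γ : ℝ) : ℝ :=
  (1 / 2) * ((1 + γ + l) / Real.sqrt ((1 - γ + l) ^ 2 + 4 * γ * l) - 1)

/-- Closed-form characterization of the MSV-Tr regularization `λ_T` in Theorem 2:
(i) for `γ ∈ (1/2, 2)` and `λ ≥ 0`, `V̄(λ, γ) = 1 ↔ λ = 3√(γ/2) − γ − 1`;
(ii) for `γ > 0`, `3√(γ/2) − γ − 1 ≥ 0 ↔ 1/2 ≤ γ ≤ 2`. -/
theorem stmt3 :
    (∀ γ ∈ Set.Ioo (1 / 2 : ℝ) 2, ∀ l : ℝ, 0 ≤ l →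
      (Vbar l γ = 1 ↔ l = 3 * Real.sqrt (γ / 2) - γ - 1)) ∧
    (∀ γ : ℝ, 0 < γ →
      (0 ≤ 3 * Real.sqrt (γ / 2) - γ - 1 ↔ 1 / 2 ≤ γ ∧ γ ≤ 2)) := by
  refine ⟨fun γ hγ l hl => ?_, fun γ hγ => ?_⟩
  · have hγ0 : 0 < γ := by linarith [hγ.1]
    have hs : 0 < Real.sqrt (γ / 2) := Real.sqrt_pos.mpr (by linarith)
    have hsq : Real.sqrt (γ / 2) ^ 2 = γ / 2 := Real.sq_sqrt (by linarith)
    have hD : 0 ≤ (1 - γ + l) ^ 2 + 4 * γ * l := by positivity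
    unfold Vbar
    generalize Real.sqrt (γ / 2) = s at hs hsq ⊢
    constructor
    · intro h
      have hr := Real.sq_sqrt hD
      have hr0 := Real.sqrt_nonneg ((1 - γ + l) ^ 2 + 4 * γ * l)
      generalize Real.sqrt ((1 - γ + l) ^ 2 + 4 * γ * l) = r at h hr hr0
      have hq : (1 + γ + l) / r = 3 := by linarith
      have hr1 : r ≠ 0 := by
        rintro rfl
        norm_num at hq
      rw [div_eq_iff hr1] at hq
      have hrs : r ^ 2 = s ^ 2 := by
        have : (1 + γ + l) ^ 2 = (3 * r) ^ 2 := by rw [hq]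
        linarith
      have : r = s := (sq_eq_sq₀ hr0 hs.le).mp hrs
      linarith
    · rintro rfl
      have hDs : (1 - γ + (3 * s - γ - 1)) ^ 2 + 4 * γ * (3 * s - γ - 1) = s ^ 2 := by
        linear_combination 8 * hsq
      rw [hDs, Real.sqrt_sq hs.le]
      field_simp
      ring
  · have hs : 0 < Real.sqrt (γ / 2) := Real.sqrt_pos.mpr (by linarith)
    have hsq : Real.sqrt (γ / 2) ^ 2 = γ / 2 := Real.sq_sqrt (by linarith)
    generalize Real.sqrt (γ / 2) = s at hs hsq ⊢
    constructor
    · intro h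
      have h1 : s ≤ 1 := by nlinarith
      have h2 : 1 / 2 ≤ s := by nlinarith
      constructor <;> nlinarith
    · rintro ⟨h1, h2⟩
      have h3 : s ≤ 1 := by nlinarith
      have h4 : 1 / 2 ≤ s := by nlinarith
      nlinarith [mul_nonneg (sub_nonneg.mpr h3) (sub_nonneg.mpr h4)]
end

section
/- Define f₁(γ, s) := 1 + s·(√(2γ) − 1)²/γ and f₂(γ, s) := (1/2)·(s − s/γ − 1 + √(4s + (1 − s + s/γ)²)) for γ > 0, s > 0. Then for all γ ∈ [1/2, 2] and all s ∈ [1, 80], one has f₂(γ, s) > 0 and f₁(γ, s)/f₂(γ, s) < 2.45. -/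
/-- `f₁(γ,s) = R̄(λ_T, γ)/σ_ε²`: asymptotic risk at the MSV-Tr regularization. -/
noncomputable def f₁ (γ s : ℝ) : ℝ := 1 + s * (Real.sqrt (2 * γ) - 1) ^ 2 / γ

/-- `f₂(γ,s) = R̄(λ*, γ)/σ_ε²`: optimal asymptotic risk. -/
noncomputable def f₂ (γ s : ℝ) : ℝ :=
  (1 / 2) * (s - s / γ - 1 + Real.sqrt (4 * s + (1 - s + s / γ) ^ 2))

/-- A quadratic in `s` that is negative at the endpoints `1` and `80`, and decreasing
enough when it is concave, is negative on `[1, 80]`. -/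
lemma quadratic_neg_of_endpoints {a b c s : ℝ} (hs1 : 1 ≤ s) (hs2 : s ≤ 80) (hc : 0 ≤ c)
    (h1 : a + b + c < 0) (h80 : 6400 * a + 80 * b + c < 0) (hab : a < 0 → b + c < 0) :
    a * s ^ 2 + b * s + c < 0 := by
  rcases lt_or_ge a 0 with ha | ha
  · nlinarith [mul_nonneg hc (sub_nonneg.2 hs1), mul_pos (neg_pos.2 ha) (pow_pos (by linarith : 0 < s) 2),
      mul_pos (neg_pos.2 (hab ha)) (by linarith : 0 < s)]
  · nlinarith [mul_nonneg ha (mul_nonneg (sub_nonneg.2 hs1) (sub_nonneg.2 hs2)),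
      mul_nonneg (neg_pos.2 h1).le (sub_nonneg.2 hs2), mul_nonneg (neg_pos.2 h80).le (sub_nonneg.2 hs1)]

lemma endpoint_quartic_neg {w : ℝ} (h0 : 0 ≤ w) (h1 : w ≤ 1 / 2) :
    6400 * (2 * w ^ 2 * (6.9 * w ^ 2 - 9.8 * w + 2.45))
      + 80 * (4 * w ^ 2 + 2.45 * (1 - 2 * w) ^ 2 - 2.45 ^ 2) + 3.45 < 0 := by
  have h1' : 0 ≤ 1 / 2 - w := by linarith
  nlinarith [mul_nonneg (mul_nonneg h0 h1') (sq_nonneg (w - 0.2)),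
    mul_nonneg h0 (sq_nonneg (w - 0.2)), mul_nonneg h1' (sq_nonneg (w - 0.2))]

/-- The defining quadratic of the optimal risk is negative at `(1 + 2 s w²) / 2.45`. -/
lemma scaled_risk_poly_neg {w s : ℝ} (h0 : 0 ≤ w) (h1 : w ≤ 1 / 2) (hs1 : 1 ≤ s) (hs2 : s ≤ 80) :
    (1 + 2 * s * w ^ 2) ^ 2 - 2.45 * (s * (1 - 2 * (1 - w) ^ 2) - 1) * (1 + 2 * s * w ^ 2)
      - 2.45 ^ 2 * s < 0 := by
  have h1' : 0 ≤ 1 / 2 - w := by linarith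
  have key := quadratic_neg_of_endpoints
    (a := 2 * w ^ 2 * (6.9 * w ^ 2 - 9.8 * w + 2.45))
    (b := 4 * w ^ 2 + 2.45 * (1 - 2 * w) ^ 2 - 2.45 ^ 2) (c := 3.45) hs1 hs2 (by norm_num)
    (by nlinarith [mul_nonneg h0 h1', mul_nonneg (sq_nonneg w) (mul_nonneg h0 h1')])
    (endpoint_quartic_neg h0 h1) (fun ha => by
      have hq : 6.9 * w ^ 2 - 9.8 * w + 2.45 < 0 := by
        by_contra! h
        exact absurd ha (not_lt.2 (by positivity))
      have hw : 1 / 4 < w := by nlinarith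
      nlinarith)
  linarith

/-- Main risk bound of Theorem 2: for `γ ∈ [1/2, 2]` and `SNR = s ∈ [1, 80]`,
`f₂(γ,s) > 0` and `f₁(γ,s)/f₂(γ,s) < 2.45`. -/
theorem stmt4 :
    ∀ γ ∈ Set.Icc (1 / 2 : ℝ) 2, ∀ s ∈ Set.Icc (1 : ℝ) 80,
      0 < f₂ γ s ∧ f₁ γ s / f₂ γ s < 2.45 := by
  rintro γ ⟨hγ1, hγ2⟩ s ⟨hs1, hs2⟩
  obtain ⟨u, hu⟩ : ∃ u, u = Real.sqrt (2 * γ) := ⟨_, rfl⟩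
  have hu2 : u ^ 2 = 2 * γ := hu ▸ Real.sq_sqrt (by linarith)
  have hu1 : 1 ≤ u := hu ▸ Real.one_le_sqrt.2 (by linarith)
  have hu3 : u ≤ 2 := hu ▸ Real.sqrt_le_iff.2 ⟨by norm_num, by linarith⟩
  have hu0 : 0 < u := by linarith
  obtain rfl : γ = u ^ 2 / 2 := by linarith
  set w := 1 - 1 / u with hw
  have hw0 : 0 ≤ w := by rw [hw, sub_nonneg, div_le_one hu0]; exact hu1
  have hw1 : w ≤ 1 / 2 := by
    have : 1 / 2 ≤ 1 / u := one_div_le_one_div_of_le hu0 hu3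
    linarith
  have hf1 : f₁ (u ^ 2 / 2) s = 1 + 2 * s * w ^ 2 := by
    rw [f₁, ← hu, hw]; field_simp
  have hsγ : s / (u ^ 2 / 2) = 2 * s * (1 - w) ^ 2 := by
    rw [hw]; field_simp; ring
  set D := Real.sqrt (4 * s + (1 - s + 2 * s * (1 - w) ^ 2) ^ 2)
  have hf2 : f₂ (u ^ 2 / 2) s = (1 / 2) * (s - 2 * s * (1 - w) ^ 2 - 1 + D) := by
    rw [f₂, hsγ]
  have key := scaled_risk_poly_neg hw0 hw1 hs1 hs2
  have hpos : 0 < f₂ (u ^ 2 / 2) s := by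
    have : 1 - s + 2 * s * (1 - w) ^ 2 < D := by
      apply Real.lt_sqrt_of_sq_lt; linarith
    rw [hf2]; linarith
  refine ⟨hpos, ?_⟩
  rw [div_lt_iff₀ hpos, hf1, hf2]
  have : 2 * (1 + 2 * s * w ^ 2) / 2.45 - (s - 2 * s * (1 - w) ^ 2 - 1) < D := by
    apply Real.lt_sqrt_of_sq_lt
    norm_num at key ⊢
    linarith
  norm_num at this ⊢
  linarith
end

section
/- Define m_F(z, γ) := (1 − γ − z − √((1 − γ − z)² − 4γz))/(2γz) and m'_F(z, γ) := ( z(1 + γ − z)/√((1 − γ − z)² − 4γz) − 1 + γ + √((1 − γ − z)² − 4γz) )/(2γz²). Then for every γ ∈ (1/2, 2) and s > 0, setting λ_T := 3√(γ/2) − γ − 1, the identity γ·( m_F(−λ_T, γ) − λ_T·(1 − s·λ_T/γ)·m'_F(−λ_T, γ) ) = 1 + s·(√(2γ) − 1)²/γ holds. -/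
/-- Stieltjes transform of the Marchenko–Pastur law with aspect ratio `γ`. -/
noncomputable def mF (z γ : ℝ) : ℝ :=
  (1 - γ - z - Real.sqrt ((1 - γ - z) ^ 2 - 4 * γ * z)) / (2 * γ * z)

/-- Derivative in `z` of the Stieltjes transform of the Marchenko–Pastur law. -/
noncomputable def mF' (z γ : ℝ) : ℝ :=
  (z * (1 + γ - z) / Real.sqrt ((1 - γ - z) ^ 2 - 4 * γ * z) - 1 + γ +
      Real.sqrt ((1 - γ - z) ^ 2 - 4 * γ * z)) / (2 * γ * z ^ 2)

/-- The discriminant at `λ_T` is a perfect square: with `γ = 2t²` its root is `t`. -/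
lemma sqrt_discriminant {t : ℝ} (ht : 0 ≤ t) :
    Real.sqrt ((1 - 2 * t ^ 2 - -((2 * t - 1) * (1 - t))) ^ 2 -
      4 * (2 * t ^ 2) * -((2 * t - 1) * (1 - t))) = t := by
  rw [show (1 - 2 * t ^ 2 - -((2 * t - 1) * (1 - t))) ^ 2 -
      4 * (2 * t ^ 2) * -((2 * t - 1) * (1 - t)) = t ^ 2 by ring, Real.sqrt_sq ht]

lemma mF_at_msvTr {t : ℝ} (h0 : 0 < t) (h1 : 2 * t - 1 ≠ 0) (h2 : 1 - t ≠ 0) :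
    mF (-((2 * t - 1) * (1 - t))) (2 * t ^ 2) = 1 / (2 * t * (1 - t)) := by
  rw [mF, sqrt_discriminant h0.le, div_eq_div_iff (by simp [h0.ne', h1, h2])
    (by simp [h0.ne', h2])]
  ring

lemma mF'_at_msvTr {t : ℝ} (h0 : 0 < t) (h1 : 2 * t - 1 ≠ 0) (h2 : 1 - t ≠ 0) :
    mF' (-((2 * t - 1) * (1 - t))) (2 * t ^ 2) = 1 / (2 * t ^ 2 * (1 - t) ^ 2) := by
  have h3 : -((2 * t - 1) * (1 - t)) * (1 + 2 * t ^ 2 - -((2 * t - 1) * (1 - t))) / t =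
      -3 * ((2 * t - 1) * (1 - t)) := by
    rw [div_eq_iff h0.ne']
    ring
  rw [mF', sqrt_discriminant h0.le, h3, div_eq_div_iff (by simp [h0.ne', h1, h2])
    (by simp [h0.ne', h2])]
  ring

/-- Closed-form risk value at the MSV-Tr regularization `λ_T = 3√(γ/2) − γ − 1`:
`γ·(m_F(−λ_T, γ) − λ_T(1 − sλ_T/γ) m'_F(−λ_T, γ)) = 1 + s(√(2γ) − 1)²/γ`
for `γ ∈ (1/2, 2)` and `s > 0`. -/
theorem stmt5 :
    ∀ γ ∈ Set.Ioo (1 / 2 : ℝ) 2, ∀ s : ℝ, 0 < s →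
      γ * (mF (-(3 * Real.sqrt (γ / 2) - γ - 1)) γ -
          (3 * Real.sqrt (γ / 2) - γ - 1) *
            (1 - s * (3 * Real.sqrt (γ / 2) - γ - 1) / γ) *
            mF' (-(3 * Real.sqrt (γ / 2) - γ - 1)) γ) =
        1 + s * (Real.sqrt (2 * γ) - 1) ^ 2 / γ := by
  intro γ hγ s _
  obtain ⟨hl, hu⟩ := hγ
  obtain ⟨t, ht⟩ : ∃ t, t = Real.sqrt (γ / 2) := ⟨_, rfl⟩
  have h0 : 0 < t := ht ▸ Real.sqrt_pos.2 (by linarith)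
  have hsq : γ = 2 * t ^ 2 := by
    rw [ht, Real.sq_sqrt (by linarith)]
    ring
  rw [← ht]
  subst hsq
  have h1 : 2 * t - 1 ≠ 0 := by nlinarith
  have h2 : 1 - t ≠ 0 := by nlinarith
  have hr : Real.sqrt (2 * (2 * t ^ 2)) = 2 * t := by
    rw [show 2 * (2 * t ^ 2) = (2 * t) ^ 2 by ring, Real.sqrt_sq (by positivity)]
  rw [hr, show 3 * t - 2 * t ^ 2 - 1 = (2 * t - 1) * (1 - t) by ring,
    mF_at_msvTr h0 h1 h2, mF'_at_msvTr h0 h1 h2]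
  field_simp
  ring
end

section
/- For all real s > 0 and γ ∈ (0, 1), setting b := 1 + s·(1/γ − 1) and c := √(4s + b²), it holds that s·(b − c)/(2γ²c) + 1/(γ − 1)² > 0. -/
/-- If `c ^ 2 = 4 * s + (1 + s * t) ^ 2` with `s, t, c > 0`, then `s * t ^ 2 * (c - b) < 2 * c`
for `b = 1 + s * t`. -/
theorem mul_sq_mul_sub_lt_two_mul {s t c : ℝ} (hs : 0 < s) (ht : 0 < t) (hc : 0 < c)
    (h : c ^ 2 = 4 * s + (1 + s * t) ^ 2) :
    s * t ^ 2 * (c - (1 + s * t)) < 2 * c := by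
  have hst : 0 < s * t := mul_pos hs ht
  have hbc : 1 + s * t < c := lt_of_pow_lt_pow_left₀ 2 hc.le (by linarith)
  have hsum : 0 < c + (1 + s * t) := by linarith
  refine lt_of_mul_lt_mul_right ?_ hsum.le
  calc s * t ^ 2 * (c - (1 + s * t)) * (c + (1 + s * t))
      = 4 * (s * t) ^ 2 := by linear_combination s * t ^ 2 * h
    _ < 2 * c * (c + (1 + s * t)) := by nlinarith


/-- The `γ < 1` case in the proof of Lemma 4: with `b = 1 + s(1/γ − 1)` and
`c = √(4s + b²)`, one has `s(b − c)/(2γ²c) + 1/(γ − 1)² > 0` for `s > 0`, `γ ∈ (0,1)`. -/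
theorem stmt6 :
    ∀ s : ℝ, 0 < s → ∀ γ ∈ Set.Ioo (0 : ℝ) 1,
      s * ((1 + s * (1 / γ - 1)) - Real.sqrt (4 * s + (1 + s * (1 / γ - 1)) ^ 2)) /
          (2 * γ ^ 2 * Real.sqrt (4 * s + (1 + s * (1 / γ - 1)) ^ 2)) +
        1 / (γ - 1) ^ 2 > 0 := by
  intro s hs γ ⟨hγ0, hγ1⟩
  have ht : 0 < 1 / γ - 1 := sub_pos.mpr (one_lt_one_div hγ0 hγ1)
  have hγt : γ * (1 / γ - 1) = 1 - γ := by field_simp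
  have hpos : 0 < 4 * s + (1 + s * (1 / γ - 1)) ^ 2 := by positivity
  have hc := Real.sqrt_pos.mpr hpos
  have key := mul_sq_mul_sub_lt_two_mul hs ht hc (Real.sq_sqrt hpos.le)
  generalize Real.sqrt (4 * s + (1 + s * (1 / γ - 1)) ^ 2) = c at *
  generalize 1 / γ - 1 = t at *
  have hden : (γ - 1) ^ 2 = (γ * t) ^ 2 := by rw [hγt]; ring
  have hsplit : s * ((1 + s * t) - c) / (2 * γ ^ 2 * c) + 1 / (γ * t) ^ 2 =
      (2 * c - s * t ^ 2 * (c - (1 + s * t))) / (2 * c * (γ * t) ^ 2) := by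
    field_simp
    ring
  rw [hden, hsplit]
  exact div_pos (sub_pos.mpr key) (by positivity)
end

section
/- For all real s > 0 and γ > 1, setting b := 1 − s·(1 − 1/γ) and c := √(4s + b²), it holds that s·(b + c)/(2γ²c) − 1/(γ − 1)² < 0. -/
/-- With `b = 1 - s u` and `c = √(4s + b²)`, the bound `1 + s u < c` and the identity
`(c + b) (c - b) = 4 s` control `s u² (b + c)`. -/
lemma mul_sq_mul_add_sqrt_lt {s u : ℝ} (hs : 0 < s) (hu : 0 < u) (hu1 : u < 1) :
    s * u ^ 2 * ((1 - s * u) + Real.sqrt (4 * s + (1 - s * u) ^ 2)) <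
      2 * Real.sqrt (4 * s + (1 - s * u) ^ 2) := by
  have hsu : 0 < s * u := mul_pos hs hu
  have hc2 : Real.sqrt (4 * s + (1 - s * u) ^ 2) ^ 2 = 4 * s + (1 - s * u) ^ 2 :=
    Real.sq_sqrt (by positivity)
  have hc : 1 + s * u < Real.sqrt (4 * s + (1 - s * u) ^ 2) :=
    Real.lt_sqrt_of_sq_lt (by nlinarith [mul_pos hs (sub_pos.2 hu1)])
  generalize Real.sqrt (4 * s + (1 - s * u) ^ 2) = c at hc hc2 ⊢
  have hcb : 0 < c - (1 - s * u) := by linarith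
  refine lt_of_mul_lt_mul_right ?_ hcb.le
  have key : s * u ^ 2 * ((1 - s * u) + c) * (c - (1 - s * u)) = 4 * (s * u) ^ 2 := by
    linear_combination s * u ^ 2 * hc2
  rw [key]
  have h : (1 + s * u) * (2 * (s * u)) < c * (c - (1 - s * u)) :=
    mul_lt_mul'' hc (by linarith) (by linarith) (by linarith)
  nlinarith

/-- The `γ > 1` case in the proof of Lemma 4: with `b = 1 − s(1 − 1/γ)` and
`c = √(4s + b²)`, one has `s(b + c)/(2γ²c) − 1/(γ − 1)² < 0` for `s > 0`, `γ > 1`. -/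
theorem stmt7 :
    ∀ s : ℝ, 0 < s → ∀ γ : ℝ, 1 < γ →
      s * ((1 - s * (1 - 1 / γ)) + Real.sqrt (4 * s + (1 - s * (1 - 1 / γ)) ^ 2)) /
          (2 * γ ^ 2 * Real.sqrt (4 * s + (1 - s * (1 - 1 / γ)) ^ 2)) -
        1 / (γ - 1) ^ 2 < 0 := by
  intro s hs γ hγ
  have hγ0 : 0 < γ := by linarith
  have hu : 0 < 1 - 1 / γ := sub_pos.2 ((div_lt_one hγ0).2 hγ)
  have hu1 : 1 - 1 / γ < 1 := sub_lt_self 1 (by positivity)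
  have h := mul_sq_mul_add_sqrt_lt hs hu hu1
  have hγu : γ - 1 = γ * (1 - 1 / γ) := by field_simp
  rw [hγu]
  have hc : 0 < Real.sqrt (4 * s + (1 - s * (1 - 1 / γ)) ^ 2) := Real.sqrt_pos.2 (by positivity)
  generalize Real.sqrt (4 * s + (1 - s * (1 - 1 / γ)) ^ 2) = c at h hc ⊢
  generalize 1 - 1 / γ = u at h hu ⊢
  rw [sub_neg, div_lt_div_iff₀ (by positivity) (by positivity)]
  linear_combination γ ^ 2 * h
end

section
/- Define f₁(γ, s) := 1 + s·(√(2γ) − 1)²/γ and f₂(γ, s) := (1/2)·(s − s/γ − 1 + √(4s + (1 − s + s/γ)²)) for γ > 0, s > 0. Then for all γ ∈ [1/2, 2] and all s ∈ [1, 80], the derivative with respect to γ of the quotient γ ↦ f₁(γ, s)/f₂(γ, s) satisfies |∂/∂γ ( f₁(γ, s)/f₂(γ, s) )| ≤ 752.2. -/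
theorem hasDerivAt_f₁ {γ : ℝ} (hγ : 0 < γ) (s : ℝ) :
    HasDerivAt (fun γ' => f₁ γ' s) (s * (√(2 * γ) - 1) / γ ^ 2) γ := by
  have hu : 0 < √(2 * γ) := Real.sqrt_pos.2 (by positivity)
  have hsq : √(2 * γ) ^ 2 = 2 * γ := Real.sq_sqrt (by positivity)
  have hsqrt : HasDerivAt (fun x : ℝ => √(2 * x)) (2 * 1 / (2 * √(2 * γ))) γ :=
    ((hasDerivAt_id γ).const_mul 2).sqrt (by simpa using hγ.ne')
  refine ((((((hsqrt.sub_const 1).pow 2).const_mul s).div (hasDerivAt_id γ) hγ.ne').const_add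
    1)).congr_deriv ?_
  simp only [id, Pi.pow_apply]
  clear hsqrt
  generalize √(2 * γ) = u at hu hsq
  norm_num
  field_simp
  linear_combination (-s * (u - 1)) * hsq

theorem hasDerivAt_f₂ {γ s : ℝ} (hγ : 0 < γ) (hs : 0 < s) :
    HasDerivAt (fun γ' => f₂ γ' s)
      (s * f₂ γ s / (γ ^ 2 * √(4 * s + (1 - s + s / γ) ^ 2))) γ := by
  have hR : 0 < √(4 * s + (1 - s + s / γ) ^ 2) := Real.sqrt_pos.2 (by positivity)
  have hdiv : HasDerivAt (fun x : ℝ => s / x) (-s / γ ^ 2) γ :=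
    ((hasDerivAt_const γ s).div (hasDerivAt_id γ) hγ.ne').congr_deriv (by simp)
  have hsqrt := (((hdiv.const_add (1 - s)).pow 2).const_add (4 * s)).sqrt
    (by simp only [Pi.pow_apply]; positivity)
  refine ((((hdiv.const_sub s).sub_const 1).add hsqrt).const_mul (1 / 2)).congr_deriv ?_
  simp only [f₂, Pi.pow_apply]
  generalize √(4 * s + (1 - s + s / γ) ^ 2) = R at hR
  norm_num
  field_simp
  ring

theorem two_fifths_le_f₂ {γ s : ℝ} (hγ : 1 / 2 ≤ γ) (hs : 1 ≤ s) : 2 / 5 ≤ f₂ γ s := by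
  have hdiv : s / γ ≤ 2 * s := by
    rw [div_le_iff₀ (by linarith)]
    nlinarith
  have hR : 4 / 5 + (1 - s + s / γ) ≤ √(4 * s + (1 - s + s / γ) ^ 2) := by
    apply Real.le_sqrt_of_sq_le
    nlinarith
  unfold f₂
  linarith

theorem sqrt_two_mul_sub_one_le {γ : ℝ} (hγ : 0 ≤ γ) : √(2 * γ) - 1 ≤ γ / 2 := by
  nlinarith [sq_nonneg (√(2 * γ) - 2), Real.sq_sqrt (show 0 ≤ 2 * γ by positivity)]

theorem f₁_le {γ s : ℝ} (hγ : 1 / 2 ≤ γ) (hs : 0 ≤ s) : f₁ γ s ≤ 1 + s * γ / 4 := by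
  have hu : 1 ≤ √(2 * γ) := Real.one_le_sqrt.2 (by linarith)
  have hsq : (√(2 * γ) - 1) ^ 2 ≤ (γ / 2) ^ 2 :=
    pow_le_pow_left₀ (by linarith) (sqrt_two_mul_sub_one_le (by linarith)) 2
  have : s * (√(2 * γ) - 1) ^ 2 / γ ≤ s * γ / 4 := by
    rw [div_le_iff₀ (by linarith)]
    nlinarith
  unfold f₁
  linarith

/-- First bound of Lemma 5: `|∂/∂γ (f₁(γ,s)/f₂(γ,s))| ≤ 752.2` for
`γ ∈ [1/2, 2]` and `s ∈ [1, 80]`. -/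
theorem stmt8 :
    ∀ γ ∈ Set.Icc (1 / 2 : ℝ) 2, ∀ s ∈ Set.Icc (1 : ℝ) 80,
      |deriv (fun γ' => f₁ γ' s / f₂ γ' s) γ| ≤ 752.2 := by
  rintro γ ⟨hγ, -⟩ s ⟨hs, hs'⟩
  have hγ0 : 0 < γ := by linarith
  have hs0 : 0 < s := by linarith
  have hf₂ := two_fifths_le_f₂ hγ hs
  have hf₂0 : 0 < f₂ γ s := by linarith
  have hf₁ := f₁_le hγ hs0.le
  have hf₁0 : 0 ≤ f₁ γ s := by unfold f₁; positivity
  have hu : 0 ≤ √(2 * γ) - 1 := sub_nonneg.2 (Real.one_le_sqrt.2 (by linarith))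
  have hu' := sqrt_two_mul_sub_one_le hγ0.le
  have hderiv := ((hasDerivAt_f₁ hγ0 s).div (hasDerivAt_f₂ hγ0 hs0) hf₂0.ne').deriv
  have hR : 0 < √(4 * s + (1 - s + s / γ) ^ 2) := Real.sqrt_pos.2 (by positivity)
  have hRs : 2 * s / 9 ≤ √(4 * s + (1 - s + s / γ) ^ 2) := by
    apply Real.le_sqrt_of_sq_le
    nlinarith [sq_nonneg (1 - s + s / γ)]
  change deriv (fun γ' => f₁ γ' s / f₂ γ' s) γ = _ at hderiv
  rw [hderiv]
  generalize √(4 * s + (1 - s + s / γ) ^ 2) = R at hR hRs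
  have hsplit : (s * (√(2 * γ) - 1) / γ ^ 2 * f₂ γ s - f₁ γ s * (s * f₂ γ s / (γ ^ 2 * R))) /
      f₂ γ s ^ 2 = s * (√(2 * γ) - 1) / γ ^ 2 / f₂ γ s - f₁ γ s / γ ^ 2 * (s / R) / f₂ γ s := by
    field_simp
  have hfst : s * (√(2 * γ) - 1) / γ ^ 2 ≤ 80 := by
    rw [div_le_iff₀ (by positivity)]
    calc s * (√(2 * γ) - 1) ≤ 80 * (γ / 2) := by gcongr
      _ ≤ 80 * γ ^ 2 := by nlinarith
  have hsnd : f₁ γ s / γ ^ 2 ≤ 44 := by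
    rw [div_le_iff₀ (by positivity)]
    nlinarith
  have hsR : s / R ≤ 9 / 2 := by
    rw [div_le_iff₀ hR]
    linarith
  have hA : s * (√(2 * γ) - 1) / γ ^ 2 / f₂ γ s ≤ 80 / (2 / 5) := by gcongr
  have hB : f₁ γ s / γ ^ 2 * (s / R) / f₂ γ s ≤ 44 * (9 / 2) / (2 / 5) := by gcongr
  have hA0 : 0 ≤ s * (√(2 * γ) - 1) / γ ^ 2 / f₂ γ s := by positivity
  have hB0 : 0 ≤ f₁ γ s / γ ^ 2 * (s / R) / f₂ γ s := by positivity
  rw [hsplit, abs_le]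
  constructor <;> linarith
end

section
/- For every real a ∈ (0, 1) and every real s ≥ 2/a², it holds that (3 − 2a)·a²·s² + (a² + 2a − 4)·s − 1 > 0. -/
/-- Polynomial positivity from the case `s ∈ (2/a², ∞)` of the proof of Lemma 4:
for `a ∈ (0,1)` and `s ≥ 2/a²`, `(3 − 2a)a²s² + (a² + 2a − 4)s − 1 > 0`. -/
theorem stmt11 :
    ∀ a ∈ Set.Ioo (0 : ℝ) 1, ∀ s : ℝ, 2 / a ^ 2 ≤ s →
      0 < (3 - 2 * a) * a ^ 2 * s ^ 2 + (a ^ 2 + 2 * a - 4) * s - 1 := by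
  rintro a ⟨ha0, ha1⟩ s hs
  have h2 : 2 ≤ s * a ^ 2 := (div_le_iff₀ (by positivity)).mp hs
  have hs0 : 0 < s := lt_of_lt_of_le (by positivity) hs
  have hs2 : 2 ≤ s := h2.trans (mul_le_of_le_one_right hs0.le (pow_le_one₀ ha0.le ha1.le))
  have h : 0 ≤ (3 - 2 * a) * s * (s * a ^ 2 - 2) :=
    mul_nonneg (mul_nonneg (by linarith) hs0.le) (by linarith)
  have h' : 0 ≤ s * (1 - a) ^ 2 := by positivity
  linarith
end

section
/- Let Φ ∈ ℝ^{n×p} be such that ΦΦᵀ is invertible, and for λ ≥ 0 define the ridge smoother S_λ := ΦΦᵀ(ΦΦᵀ + λI_n)⁻¹. Then λ = 0 is the unique minimizer over λ ∈ [0, ∞) of ‖(1/n)I_n − (1/n)S_λᵀS_λ‖_F, and also the unique minimizer of ‖(1/n)I_n − (1/n)S_λ‖_F; in both cases the minimum value is 0, attained only at λ = 0. -/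
open Matrix

/-- Frobenius norm of a real square matrix. -/
noncomputable def frobNorm {n : ℕ} (A : Matrix (Fin n) (Fin n) ℝ) : ℝ :=
  Real.sqrt (∑ i, ∑ j, (A i j) ^ 2)

theorem frobNorm_eq_zero_iff {n : ℕ} (A : Matrix (Fin n) (Fin n) ℝ) :
    frobNorm A = 0 ↔ A = 0 := by
  rw [frobNorm, Real.sqrt_eq_zero (by positivity),
    Finset.sum_eq_zero_iff_of_nonneg fun i _ => by positivity, ← Matrix.ext_iff]
  refine forall_congr' fun i => ?_
  rw [Finset.sum_eq_zero_iff_of_nonneg fun j _ => by positivity]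
  simp

theorem frobNorm_inv_smul_one_sub_eq_zero_iff {n : ℕ} (hn : 0 < n)
    (A : Matrix (Fin n) (Fin n) ℝ) :
    frobNorm ((n : ℝ)⁻¹ • (1 : Matrix (Fin n) (Fin n) ℝ) - (n : ℝ)⁻¹ • A) = 0 ↔ A = 1 := by
  have hn' : (n : ℝ)⁻¹ ≠ 0 := by positivity
  rw [frobNorm_eq_zero_iff, ← smul_sub, smul_eq_zero_iff_right hn', sub_eq_zero, eq_comm]

theorem frobNorm_inv_smul_one_sub_pos {n : ℕ} (hn : 0 < n)
    {A : Matrix (Fin n) (Fin n) ℝ} (hA : A ≠ 1) :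
    0 < frobNorm ((n : ℝ)⁻¹ • (1 : Matrix (Fin n) (Fin n) ℝ) - (n : ℝ)⁻¹ • A) :=
  lt_of_le_of_ne (Real.sqrt_nonneg _)
    (Ne.symm (mt (frobNorm_inv_smul_one_sub_eq_zero_iff hn A).1 hA))

/-- A ridge smoother with positive regularization is never orthogonal. -/
theorem ridge_transpose_mul_self_ne_one {n p : ℕ} (hn : 0 < n)
    (Φ : Matrix (Fin n) (Fin p) ℝ) {l : ℝ} (hl : 0 < l) :
    (Φ * Φᵀ * (Φ * Φᵀ + l • 1)⁻¹)ᵀ * (Φ * Φᵀ * (Φ * Φᵀ + l • 1)⁻¹) ≠ 1 := by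
  intro h
  have hdiag : 0 ≤ (Φ * Φᵀ) ⟨0, hn⟩ ⟨0, hn⟩ := by
    simp only [mul_apply, transpose_apply]
    exact Finset.sum_nonneg fun k _ => mul_self_nonneg _
  have hsymm : (Φ * Φᵀ)ᵀ = Φ * Φᵀ := by simp
  have hpos : (Φ * Φᵀ).PosSemidef := by
    simpa using posSemidef_self_mul_conjTranspose Φ
  have hdet : IsUnit (Φ * Φᵀ + l • (1 : Matrix (Fin n) (Fin n) ℝ)).det :=
    (isUnit_iff_isUnit_det _).1 (PosDef.posSemidef_add hpos (PosDef.one.smul hl)).isUnit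
  generalize Φ * Φᵀ = G at *
  set M := G + l • (1 : Matrix (Fin n) (Fin n) ℝ) with hM
  have hMsymm : Mᵀ = M := by simp [hM, hsymm]
  have hsq : G * G = M * M := by
    rw [transpose_mul, transpose_nonsing_inv, hMsymm, hsymm] at h
    calc G * G = (M * M⁻¹) * (G * G) * (M⁻¹ * M) := by
          rw [mul_nonsing_inv _ hdet, nonsing_inv_mul _ hdet, one_mul, mul_one]
      _ = M * (M⁻¹ * G * (G * M⁻¹)) * M := by simp only [Matrix.mul_assoc]
      _ = M * M := by rw [h, mul_one]
  have hzero : (2 * l) • G + (l * l) • (1 : Matrix (Fin n) (Fin n) ℝ) = 0 := by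
    have hexp : M * M = G * G + ((2 * l) • G + (l * l) • 1) := by
      simp only [hM, add_mul, mul_add, smul_mul_assoc, mul_smul_comm, one_mul, mul_one]
      module
    exact left_eq_add.1 (hsq.trans hexp)
  have hentry := congrFun₂ hzero ⟨0, hn⟩ ⟨0, hn⟩
  simp only [Matrix.add_apply, Matrix.smul_apply, one_apply_eq, Matrix.zero_apply,
    smul_eq_mul] at hentry
  nlinarith [mul_nonneg hl.le hdiag, mul_pos hl hl]

/-- Part (b) of Theorem 3: for the ridge smoother `S_λ = ΦΦᵀ(ΦΦᵀ + λIₙ)⁻¹` with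
`ΦΦᵀ` invertible, `λ = 0` is the unique minimizer over `λ ∈ [0,∞)` of both
`‖(1/n)Iₙ − (1/n)S_λᵀS_λ‖_F` and `‖(1/n)Iₙ − (1/n)S_λ‖_F`; in both cases the
minimum value is `0`, attained only at `λ = 0`. -/
theorem stmt13 {n p : ℕ} (hn : 0 < n) (Φ : Matrix (Fin n) (Fin p) ℝ)
    (hinv : IsUnit (Φ * Φᵀ)) :
    (frobNorm ((n : ℝ)⁻¹ • (1 : Matrix (Fin n) (Fin n) ℝ) -
        (n : ℝ)⁻¹ • ((Φ * Φᵀ * (Φ * Φᵀ + (0 : ℝ) • 1)⁻¹)ᵀ *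
          (Φ * Φᵀ * (Φ * Φᵀ + (0 : ℝ) • 1)⁻¹))) = 0 ∧
      ∀ l : ℝ, 0 < l →
        0 < frobNorm ((n : ℝ)⁻¹ • (1 : Matrix (Fin n) (Fin n) ℝ) -
          (n : ℝ)⁻¹ • ((Φ * Φᵀ * (Φ * Φᵀ + l • 1)⁻¹)ᵀ *
            (Φ * Φᵀ * (Φ * Φᵀ + l • 1)⁻¹)))) ∧
    (frobNorm ((n : ℝ)⁻¹ • (1 : Matrix (Fin n) (Fin n) ℝ) -
        (n : ℝ)⁻¹ • (Φ * Φᵀ * (Φ * Φᵀ + (0 : ℝ) • 1)⁻¹)) = 0 ∧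
      ∀ l : ℝ, 0 < l →
        0 < frobNorm ((n : ℝ)⁻¹ • (1 : Matrix (Fin n) (Fin n) ℝ) -
          (n : ℝ)⁻¹ • (Φ * Φᵀ * (Φ * Φᵀ + l • 1)⁻¹))) := by
  have hS : Φ * Φᵀ * (Φ * Φᵀ + (0 : ℝ) • 1)⁻¹ = 1 := by
    rw [zero_smul, add_zero, mul_nonsing_inv _ ((isUnit_iff_isUnit_det _).1 hinv)]
  refine ⟨⟨?_, fun l hl => ?_⟩, ?_, fun l hl => ?_⟩
  · rw [frobNorm_inv_smul_one_sub_eq_zero_iff hn, hS, transpose_one, one_mul]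
  · exact frobNorm_inv_smul_one_sub_pos hn (ridge_transpose_mul_self_ne_one hn Φ hl)
  · rwa [frobNorm_inv_smul_one_sub_eq_zero_iff hn]
  · refine frobNorm_inv_smul_one_sub_pos hn fun h => ?_
    exact ridge_transpose_mul_self_ne_one hn Φ hl (by rw [h, transpose_one, one_mul])
end

section
/- Let n ≥ 1 and let s₁, …, sₙ be reals with 0 < s_i² < n for every i. Define h(t) := Σᵢ (1/n − ((1 − exp(−t·s_i²))/s_i)²)² for t ∈ [0, ∞). Then: (i) there exists t ∈ (0, ∞) with h(t) < h(0) = 1/n; and (ii) there exists t ∈ (0, ∞) with h(t) < lim_{t→∞} h(t) = Σᵢ (1/n − 1/s_i²)². -/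
open Filter Topology

/-- For `s ≠ 0` and `t > 0`, the gradient-flow filter factor lies strictly between `0` and `1/s²`. -/
lemma sq_filter_factor_mem_Ioo {s t : ℝ} (hs : 0 < s ^ 2) (ht : 0 < t) :
    ((1 - Real.exp (-t * s ^ 2)) / s) ^ 2 ∈ Set.Ioo 0 (1 / s ^ 2) := by
  have hpos := Real.exp_pos (-t * s ^ 2)
  have hlt : Real.exp (-t * s ^ 2) < 1 := by
    rw [Real.exp_lt_one_iff]
    nlinarith [mul_pos ht hs]
  rw [div_pow]
  refine ⟨div_pos (pow_pos (by linarith) 2) hs, ?_⟩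
  exact div_lt_div_of_pos_right (by nlinarith) hs

lemma tendsto_sq_filter_factor_zero (s : ℝ) :
    Tendsto (fun t : ℝ => ((1 - Real.exp (-t * s ^ 2)) / s) ^ 2) (𝓝 0) (𝓝 0) := by
  have hc : Continuous (fun t : ℝ => ((1 - Real.exp (-t * s ^ 2)) / s) ^ 2) := by fun_prop
  simpa using hc.tendsto 0

lemma tendsto_sq_filter_factor_atTop {s : ℝ} (hs : 0 < s ^ 2) :
    Tendsto (fun t : ℝ => ((1 - Real.exp (-t * s ^ 2)) / s) ^ 2) atTop (𝓝 (1 / s ^ 2)) := by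
  have he : Tendsto (fun t : ℝ => Real.exp (-t * s ^ 2)) atTop (𝓝 0) :=
    Real.tendsto_exp_atBot.comp (tendsto_neg_atTop_atBot.atBot_mul_const hs)
  simpa [div_pow] using ((he.const_sub 1).div_const s).pow 2

/-- Part (c) of Theorem 6 (y-free out-of-sample MSV for gradient flow): with
`0 < s_i² < n` and `h(t) = ∑ᵢ (1/n − ((1 − e^{−t s_i²})/s_i)²)²` the squared
Frobenius norm of the criterion at training time `t`:
(i) some `t > 0` has `h(t) < h(0) = 1/n`; and
(ii) some `t > 0` has `h(t) < lim_{t→∞} h(t) = ∑ᵢ (1/n − 1/s_i²)²`. -/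
theorem stmt15 {n : ℕ} (hn : 1 ≤ n) (s : Fin n → ℝ)
    (hs : ∀ i, 0 < (s i) ^ 2 ∧ (s i) ^ 2 < n)
    (h : ℝ → ℝ)
    (hdef : ∀ t : ℝ,
      h t = ∑ i, ((n : ℝ)⁻¹ - ((1 - Real.exp (-t * (s i) ^ 2)) / s i) ^ 2) ^ 2) :
    h 0 = 1 / n ∧
    (∃ t : ℝ, 0 < t ∧ h t < h 0) ∧
    Filter.Tendsto h Filter.atTop (nhds (∑ i, ((n : ℝ)⁻¹ - 1 / (s i) ^ 2) ^ 2)) ∧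
    (∃ t : ℝ, 0 < t ∧ h t < ∑ i, ((n : ℝ)⁻¹ - 1 / (s i) ^ 2) ^ 2) := by
  have hn0 : (0 : ℝ) < n := by exact_mod_cast hn
  have hinv : (0 : ℝ) < (n : ℝ)⁻¹ := inv_pos.mpr hn0
  have : Nonempty (Fin n) := ⟨⟨0, hn⟩⟩
  refine ⟨?_, ?_, ?_, ?_⟩
  · rw [hdef]
    simp
    field_simp
  · have hev : ∀ᶠ t in 𝓝[>] (0 : ℝ),
        ∀ i, ((1 - Real.exp (-t * (s i) ^ 2)) / s i) ^ 2 < 2 * (n : ℝ)⁻¹ :=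
      eventually_all.2 fun i =>
        ((tendsto_sq_filter_factor_zero (s i)).mono_left nhdsWithin_le_nhds).eventually_lt_const
          (by positivity)
    obtain ⟨t, hlt, ht⟩ := (hev.and self_mem_nhdsWithin).exists
    refine ⟨t, ht, ?_⟩
    rw [hdef, hdef]
    refine Finset.sum_lt_sum_of_nonempty Finset.univ_nonempty fun i _ => ?_
    have hmem := (sq_filter_factor_mem_Ioo (hs i).1 ht).1
    simp only [neg_zero, zero_mul, Real.exp_zero, sub_self, zero_div, ne_eq, OfNat.ofNat_ne_zero,
      not_false_eq_true, zero_pow, sub_zero]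
    nlinarith [mul_pos hmem (sub_pos.2 (hlt i))]
  · rw [funext hdef]
    exact tendsto_finsetSum _ fun i _ =>
      ((tendsto_sq_filter_factor_atTop (hs i).1).const_sub _).pow 2
  · have hev : ∀ᶠ t in atTop,
        ∀ i, (n : ℝ)⁻¹ < ((1 - Real.exp (-t * (s i) ^ 2)) / s i) ^ 2 :=
      eventually_all.2 fun i =>
        (tendsto_sq_filter_factor_atTop (hs i).1).eventually_const_lt
          (by rw [inv_eq_one_div]; exact one_div_lt_one_div_of_lt (hs i).1 (hs i).2)
    obtain ⟨t, hlt, ht⟩ := (hev.and (eventually_gt_atTop 0)).exists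
    refine ⟨t, ht, ?_⟩
    rw [hdef]
    refine Finset.sum_lt_sum_of_nonempty Finset.univ_nonempty fun i _ => ?_
    have hmem := (sq_filter_factor_mem_Ioo (hs i).1 ht).2
    nlinarith [hlt i]
end

section
/- Let n ≥ 1 and let s₁, …, sₙ be nonnegative reals with s_j = 0 for at least one index j. Then for every λ ≥ maxᵢ (√(n/2)·s_i − s_i²) with λ ≥ 0, it holds that |1/n − s_i²/(s_i² + λ)²| ≤ 1/n for every i, and consequently maxᵢ |1/n − s_i²/(s_i² + λ)²| = 1/n. -/
/-- Singular case in part (c) of Theorem 8: if the `s_i ≥ 0` include a zero value,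
then for every `λ ≥ maxᵢ(√(n/2) s_i − s_i²)` with `λ ≥ 0`,
`|1/n − s_i²/(s_i² + λ)²| ≤ 1/n` for every `i`, and hence
`maxᵢ |1/n − s_i²/(s_i² + λ)²| = 1/n`. -/
theorem stmt16 {n : ℕ} (hn : 1 ≤ n) (s : Fin n → ℝ) (hs : ∀ i, 0 ≤ s i)
    (j : Fin n) (hj : s j = 0) (l : ℝ) (hl0 : 0 ≤ l)
    (hl : ∀ i, Real.sqrt (n / 2) * s i - (s i) ^ 2 ≤ l) :
    (∀ i, |(n : ℝ)⁻¹ - (s i) ^ 2 / ((s i) ^ 2 + l) ^ 2| ≤ (n : ℝ)⁻¹) ∧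
    IsGreatest (Set.range fun i => |(n : ℝ)⁻¹ - (s i) ^ 2 / ((s i) ^ 2 + l) ^ 2|)
      ((n : ℝ)⁻¹) := by
  have bound : ∀ i, |(n : ℝ)⁻¹ - (s i) ^ 2 / ((s i) ^ 2 + l) ^ 2| ≤ (n : ℝ)⁻¹ := by
    intro i
    have hn' : (0 : ℝ) < n := by exact_mod_cast hn
    have hsq : (n / 2 : ℝ) * s i ^ 2 ≤ (s i ^ 2 + l) ^ 2 := by
      have h := pow_le_pow_left₀ (mul_nonneg (Real.sqrt_nonneg (n / 2 : ℝ)) (hs i))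
        (sub_le_iff_le_add'.mp (hl i)) 2
      rwa [mul_pow, Real.sq_sqrt (by positivity)] at h
    have hle : s i ^ 2 / (s i ^ 2 + l) ^ 2 ≤ 2 * (n : ℝ)⁻¹ := by
      refine div_le_of_le_mul₀ (by positivity) (by positivity) ?_
      calc s i ^ 2 = 2 * (n : ℝ)⁻¹ * (n / 2 * s i ^ 2) := by field_simp
        _ ≤ 2 * (n : ℝ)⁻¹ * (s i ^ 2 + l) ^ 2 := by gcongr
    have hnonneg : 0 ≤ s i ^ 2 / (s i ^ 2 + l) ^ 2 := by positivity
    exact abs_le.mpr ⟨by linarith, by linarith⟩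
  exact ⟨bound, ⟨j, by simp [hj]⟩, Set.forall_mem_range.mpr bound⟩
end

section
/- Let n, m ≥ 1, N := n + m, and let γ, η ∈ ℝ. Let (K⋆_k)_{k≥1} be an arbitrary sequence of matrices in ℝ^{N×n}, let y ∈ ℝ^n, and let f⋆₀ ∈ ℝ^N with top block f₀ ∈ ℝ^n (its first n entries). Define sequences S⋆_{−1} = S⋆₀ = 0 ∈ ℝ^{N×n} and f'⋆_{−1} = f'⋆₀ = f⋆₀ ∈ ℝ^N, and for k ≥ 0: S⋆_{k+1} = S⋆_k + γ(S⋆_k − S⋆_{k−1}) + η·K⋆_{k+1}·(I_n − S_k), and f'⋆_{k+1} = f'⋆_k + γ(f'⋆_k − f'⋆_{k−1}) + η·K⋆_{k+1}·(y − f'_k), where S_k ∈ ℝ^{n×n} denotes the top n rows of S⋆_k and f'_k ∈ ℝ^n the first n entries of f'⋆_k. Then for every k ≥ 0, f'⋆_k = S⋆_k·(y − f₀) + f⋆₀. -/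
open Matrix

/-- The exact smoother identity from the proof of Theorem 7: for gradient descent
with momentum `γ` and learning rate `η`, with generalized NTK matrices `K⋆_k`,
the iterates `f'⋆_k` defined by the stated recursion (with `S⋆_{−1} = S⋆_0 = 0`
and `f'⋆_{−1} = f'⋆_0 = f⋆_0`, encoded via truncated subtraction `k − 1` on `ℕ`)
satisfy `f'⋆_k = S⋆_k (y − f_0) + f⋆_0` for all `k ≥ 0`.  Here `ℝ^N = ℝ^{n+m}`
and the "top block" of a vector/matrix consists of its first `n` rows. -/
theorem stmt17 {n m : ℕ} (hn : 1 ≤ n) (hm : 1 ≤ m) (γ η : ℝ)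
    (K : ℕ → Matrix (Fin (n + m)) (Fin n) ℝ)
    (y : Fin n → ℝ) (f0star : Fin (n + m) → ℝ)
    (S : ℕ → Matrix (Fin (n + m)) (Fin n) ℝ)
    (f' : ℕ → Fin (n + m) → ℝ)
    (hS0 : S 0 = 0)
    (hf0 : f' 0 = f0star)
    (hSrec : ∀ k : ℕ, S (k + 1) = S k + γ • (S k - S (k - 1)) +
      η • (K (k + 1) *
        ((1 : Matrix (Fin n) (Fin n) ℝ) -
          Matrix.of fun i j : Fin n => S k (Fin.castAdd m i) j)))
    (hfrec : ∀ k : ℕ, f' (k + 1) = f' k + γ • (f' k - f' (k - 1)) +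
      η • (K (k + 1)).mulVec (y - fun i : Fin n => f' k (Fin.castAdd m i))) :
    ∀ k : ℕ, f' k = (S k).mulVec (y - fun i : Fin n => f0star (Fin.castAdd m i)) + f0star := by
  set f₀ : Fin n → ℝ := fun i => f0star (Fin.castAdd m i)
  intro k
  induction k using Nat.strong_induction_on with
  | _ k ih =>
    obtain _ | k := k
    · simp [hS0, hf0]
    · have hk := ih k (by omega)
      have hk' := ih (k - 1) (by omega)
      have hres : (y - fun i : Fin n => f' k (Fin.castAdd m i)) =
          ((1 : Matrix (Fin n) (Fin n) ℝ) -
            Matrix.of fun i j : Fin n => S k (Fin.castAdd m i) j) *ᵥ (y - f₀) := by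
        have htop : (fun i : Fin n => f' k (Fin.castAdd m i)) =
            (Matrix.of fun i j : Fin n => S k (Fin.castAdd m i) j) *ᵥ (y - f₀) + f₀ := by
          rw [hk]
          rfl
        rw [htop, sub_mulVec, one_mulVec]
        abel
      rw [hfrec, hSrec, hres, hk, hk', mulVec_mulVec]
      simp only [add_mulVec, smul_mulVec, sub_mulVec, add_sub_add_right_eq_sub]
      abel
end
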